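/- Let f ∈ H(b), let λ ∈ D, and let g ∈ H^2 be the unique function such that conj(b)·f = conj(a)·f^+ + conj(z)·conj(g) a.e. on T. Then f·k_λ belongs to H(b) and (f·k_λ)^+ = f^+·k_λ + (conj(λ·g(λ))/conj(a(λ)))·k_λ. -/

import Mathlib

open MeasureTheory Complex Filter Set Metric
open scoped ComplexConjugate

noncomputable section

/-- The circle group `ℝ / 2πℤ`, parametrizing the unit circle `𝕋`. -/
instance fact_two_pi_pos : Fact (0 < 2 * Real.pi) := ⟨by positivity⟩

abbrev Tc : Type := AddCircle (2 * Real.pi)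

/-- Normalized Lebesgue measure on the circle. -/
def m : Measure Tc := AddCircle.haarAddCircle

instance : IsProbabilityMeasure m := by unfold m; infer_instance

/-- The point `e^{iθ}` of the unit circle corresponding to `θ ∈ ℝ/2πℤ`. -/
def bd (θ : Tc) : ℂ := (AddCircle.toCircle θ : ℂ)

/-- The open unit disc. -/
abbrev uDisc : Set ℂ := Metric.ball (0 : ℂ) 1

/-- A function holomorphic on the open unit disc. -/
def HolDisc (f : ℂ → ℂ) : Prop := DifferentiableOn ℂ f uDisc

/-- `F` is the radial (a.e.) boundary function of `f`. -/
def IsBdry (f : ℂ → ℂ) (F : Tc → ℂ) : Prop :=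
  ∀ᵐ θ ∂m, Tendsto (fun r : ℝ => f ((r : ℂ) * bd θ)) (nhdsWithin 1 (Set.Iio 1)) (nhds (F θ))

/-- Membership in the Hardy space `H^p` of the unit disc, `0 < p < ∞`. -/
def MemHp (p : ℝ) (f : ℂ → ℂ) : Prop :=
  HolDisc f ∧ ∃ C : ℝ, ∀ r : ℝ, 0 ≤ r → r < 1 →
    (∫ θ : Tc, ‖f ((r : ℂ) * bd θ)‖ ^ p ∂m) ≤ C

/-- Membership in `H^∞`: bounded holomorphic functions on the disc. -/
def MemHinf (f : ℂ → ℂ) : Prop := HolDisc f ∧ ∃ C : ℝ, ∀ z ∈ uDisc, ‖f z‖ ≤ C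

/-- Outer functions on the unit disc. -/
def OuterFn (f : ℂ → ℂ) : Prop :=
  HolDisc f ∧ ∃ (α : ℂ) (w : Tc → ℝ), ‖α‖ = 1 ∧ (∀ θ, 0 ≤ w θ) ∧
    Integrable (fun θ => Real.log (w θ)) m ∧
    ∀ z ∈ uDisc,
      f z = α * Complex.exp (∫ θ : Tc, ((bd θ + z) / (bd θ - z)) * (Real.log (w θ) : ℂ) ∂m)

/-- Inner functions: `Θ` holomorphic bounded by one, with unimodular boundary values `Θs`. -/
def InnerFn (Θ : ℂ → ℂ) (Θs : Tc → ℂ) : Prop :=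
  HolDisc Θ ∧ (∀ z ∈ uDisc, ‖Θ z‖ ≤ 1) ∧ IsBdry Θ Θs ∧ (∀ᵐ θ ∂m, ‖Θs θ‖ = 1)

/-- `L²(𝕋, m)`. -/
abbrev L2 : Type := Lp ℂ 2 m

/-- The Hardy space `H²`, viewed inside `L²(𝕋)` as the functions whose negative
Fourier coefficients vanish. -/
def H2 : Set L2 := {F | ∀ n : ℤ, n < 0 → fourierCoeff (F : Tc → ℂ) n = 0}

/-- The Cauchy kernel `k_λ(z) = 1/(1 - conj(λ) z)`. -/
def ker (lam z : ℂ) : ℂ := (1 - conj lam * z)⁻¹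

/-- Divergence of `Σ (1 - |λ_n|)` (for `λ_n` in the unit disc this is the negation of
the Blaschke condition). -/
def NotBlaschke (lam : ℕ → ℂ) : Prop := ¬ Summable (fun n => 1 - ‖lam n‖)

/-- A bundle recording: a non-constant function `b` in the closed unit ball of `H^∞`
with `log(1 - |b|) ∈ L¹(𝕋)`, its Pythagorean mate `a` (outer, `a(0) > 0`,
`|a|² + |b|² = 1` a.e.), together with their boundary functions `bs`, `as'`. -/
structure BPair where
  b : ℂ → ℂ
  a : ℂ → ℂ
  bs : Tc → ℂ
  as' : Tc → ℂ
  b_hol : HolDisc b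
  b_le_one : ∀ z ∈ uDisc, ‖b z‖ ≤ 1
  b_nonconst : ¬ ∃ c : ℂ, ∀ z ∈ uDisc, b z = c
  b_bdry : IsBdry b bs
  log_int : Integrable (fun θ => Real.log (1 - ‖bs θ‖)) m
  a_outer : OuterFn a
  a_bdry : IsBdry a as'
  a0_pos : ∃ r : ℝ, 0 < r ∧ a 0 = (r : ℂ)
  pyth : ∀ᵐ θ ∂m, ‖as' θ‖ ^ 2 + ‖bs θ‖ ^ 2 = 1

/-- The defining relation of `H(b)`: `T_{conj b} F = T_{conj a} F⁺`, i.e. all nonnegative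
Fourier coefficients of `conj(b)·F - conj(a)·F⁺` vanish, with `F, F⁺ ∈ H²`. -/
def HbMem (P : BPair) (F Fp : L2) : Prop :=
  F ∈ H2 ∧ Fp ∈ H2 ∧ ∀ n : ℤ, 0 ≤ n →
    fourierCoeff (fun θ => conj (P.bs θ) * (F : Tc → ℂ) θ - conj (P.as' θ) * (Fp : Tc → ℂ) θ) n = 0

/-- The ambient Hilbert space `L² ×_2 L²` in which `H(b)` embeds isometrically via
`f ↦ (f, f⁺)`; its norm is `‖(F, F⁺)‖² = ‖F‖₂² + ‖F⁺‖₂²`, the `H(b)` norm. -/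
abbrev HbP : Type := WithLp 2 (L2 × L2)

def fst2 (p : HbP) : L2 := ((WithLp.equiv 2 (L2 × L2)) p).1
def snd2 (p : HbP) : L2 := ((WithLp.equiv 2 (L2 × L2)) p).2

/-- The de Branges–Rovnyak space `H(b)`, as the set of pairs `(f, f⁺)`. -/
def HbSet (P : BPair) : Set HbP := {p | HbMem P (fst2 p) (snd2 p)}

/-- `q` represents the element `φ · f` of `H(b)`, where `p` represents `f` and `φs` is a
boundary function: `q ∈ H(b)` and the first component of `q` is `φs` times that of `p`. -/
def MulRep (P : BPair) (φs : Tc → ℂ) (p q : HbP) : Prop :=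
  q ∈ HbSet P ∧ (fst2 q : Tc → ℂ) =ᵐ[m] fun θ => φs θ * (fst2 p : Tc → ℂ) θ

/-- `Zf` is the family of elements `z^n·f`, `n ≥ 0`, of `H(b)`, where `p` represents `f`. -/
def ZFamily (P : BPair) (p : HbP) (Zf : ℕ → HbP) : Prop :=
  ∀ n : ℕ, MulRep P (fun θ => (bd θ) ^ n) p (Zf n)

/-- `f` (represented by the pair `p`) is cyclic for `S_b`: the linear span of
`{z^n f : n ≥ 0}` is dense in `H(b)`. -/
def CyclicSb (P : BPair) (p : HbP) : Prop :=
  p ∈ HbSet P ∧ ∀ Zf : ℕ → HbP, ZFamily P p Zf →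
    closure (↑(Submodule.span ℂ (Set.range Zf)) : Set HbP) = HbSet P

/-- `FK` is the family of elements `f·k_{λ_n}`, `n ≥ 0`, of `H(b)`. -/
def KFamily (P : BPair) (lam : ℕ → ℂ) (p : HbP) (FK : ℕ → HbP) : Prop :=
  ∀ n : ℕ, MulRep P (fun θ => ker (lam n) (bd θ)) p (FK n)

/-- `C` is a bound for the norm of the shift `S_b` on `H(b)`. -/
def ShiftBound (P : BPair) (C : ℝ) : Prop :=
  0 ≤ C ∧ ∀ p q : HbP, p ∈ HbSet P → MulRep P (fun θ => bd θ) p q → ‖q‖ ≤ C * ‖p‖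

/-- `N = ‖S_b‖`, the operator norm of the shift on `H(b)`. -/
def IsShiftNorm (P : BPair) (N : ℝ) : Prop :=
  ShiftBound P N ∧ ∀ C : ℝ, ShiftBound P C → N ≤ C

/-- `μ` is the Aleksandrov–Clark measure `μ_α` of `b`. -/
def IsACMeasure (P : BPair) (α : ℂ) (μ : Measure Tc) : Prop :=
  IsFiniteMeasure μ ∧ ∀ z ∈ uDisc,
    (1 - ‖P.b z‖ ^ 2) / ‖1 - conj α * P.b z‖ ^ 2 = ∫ θ : Tc, (1 - ‖z‖ ^ 2) / ‖z - bd θ‖ ^ 2 ∂μ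


theorem bd_cont : Continuous bd := by
  unfold bd; exact continuous_subtype_val.comp AddCircle.continuous_toCircle

theorem bd_norm (θ : Tc) : ‖bd θ‖ = 1 := Circle.norm_coe _

theorem bd_coe (t : ℝ) : bd (t : Tc) = circleMap 0 1 t := by
  unfold bd
  rw [AddCircle.toCircle_apply_mk, Circle.coe_exp, circleMap]
  simp

theorem fourier_nat (n : ℕ) (θ : Tc) : fourier (n : ℤ) θ = bd θ ^ n := by
  rw [fourier_apply, bd, natCast_zsmul, AddCircle.toCircle_nsmul]; simp

theorem integral_bd {E : Type*} [NormedAddCommGroup E] [NormedSpace ℝ E] (φ : ℂ → E) :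
    ∫ θ, φ (bd θ) ∂m = Real.circleAverage φ 0 1 := by
  unfold m
  rw [AddCircle.integral_haarAddCircle, Real.circleAverage_def,
    ← AddCircle.intervalIntegral_preimage (2 * Real.pi) 0]
  simp only [bd_coe, zero_add]

theorem one_sub_ne {lam : ℂ} (hlam : lam ∈ uDisc) {z : ℂ} (hz : ‖z‖ ≤ 1) :
    1 - conj lam * z ≠ 0 := by
  intro h
  have h1 : conj lam * z = 1 := (sub_eq_zero.1 h).symm
  have h2 := congrArg norm h1
  rw [norm_mul, RCLike.norm_conj, norm_one] at h2
  have h3 : ‖lam‖ < 1 := by simpa using hlam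
  nlinarith [norm_nonneg lam, norm_nonneg z]

theorem ker_cont {lam : ℂ} (hlam : lam ∈ uDisc) : Continuous fun θ => ker lam (bd θ) := by
  unfold _root_.ker
  exact Continuous.inv₀ (continuous_const.sub (continuous_const.mul bd_cont))
    fun θ => one_sub_ne hlam (bd_norm θ).le

theorem bd_sub_ne {lam : ℂ} (hlam : lam ∈ uDisc) (θ : Tc) : bd θ - lam ≠ 0 := by
  intro h
  have h3 : ‖lam‖ < 1 := by simpa using hlam
  rw [← sub_eq_zero.1 h, bd_norm] at h3
  exact lt_irrefl _ h3

theorem bd_conj (θ : Tc) : bd θ * conj (bd θ) = 1 := by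
  rw [Complex.mul_conj, Complex.normSq_eq_norm_sq, bd_norm]; simp

theorem bd_ne (θ : Tc) : bd θ ≠ 0 := by
  intro h; have := bd_conj θ; simp [h] at this

theorem conj_ker {lam : ℂ} (hlam : lam ∈ uDisc) (θ : Tc) :
    conj (ker lam (bd θ)) = bd θ / (bd θ - lam) := by
  unfold _root_.ker
  have h := bd_sub_ne hlam θ
  have h2 : 1 - lam * conj (bd θ) ≠ 0 := by
    intro h0
    apply h
    have := congrArg (fun x => bd θ * x) h0
    simp only [mul_zero] at this
    linear_combination this + lam * bd_conj θ
  simp only [map_inv₀, map_sub, map_one, map_mul, Complex.conj_conj]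
  rw [eq_div_iff h, inv_mul_eq_iff_eq_mul₀ h2]
  linear_combination lam * bd_conj θ

/-- Cauchy's formula on the circle. -/
theorem cauchy {φ : ℂ → ℂ} (hφ : DiffContOnCl ℂ φ (ball 0 1)) {lam : ℂ} (hlam : lam ∈ uDisc) :
    ∫ θ, φ (bd θ) * conj (ker lam (bd θ)) ∂m = φ lam := by
  have := DiffContOnCl.circleAverage_smul_div (R := 1) (c := 0) (f := φ) (w := lam)
    (by simpa using hφ) (by simpa using hlam)
  rw [← integral_bd] at this
  rw [← this]
  refine integral_congr_ae (Eventually.of_forall fun θ => ?_)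
  simp only [conj_ker hlam, sub_zero, smul_eq_mul]
  ring

theorem rmul_mem {r : ℝ} (h0 : 0 ≤ r) (h1 : r < 1) {z : ℂ} (hz : ‖z‖ ≤ 1) :
    (r : ℂ) * z ∈ uDisc := by
  simp only [Metric.mem_ball, dist_zero_right, norm_mul, Complex.norm_real, Real.norm_eq_abs,
    abs_of_nonneg h0]
  nlinarith [norm_nonneg z]

theorem dilate_diffCont {h : ℂ → ℂ} (hh : HolDisc h) {r : ℝ} (h0 : 0 ≤ r) (h1 : r < 1) (n : ℕ) :
    DiffContOnCl ℂ (fun z => h ((r : ℂ) * z) * z ^ n) (ball 0 1) := by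
  apply DifferentiableOn.diffContOnCl
  rw [closure_ball _ one_ne_zero]
  refine DifferentiableOn.mul ?_ (by fun_prop)
  refine DifferentiableOn.comp (t := uDisc) hh (by fun_prop) ?_
  intro z hz
  exact rmul_mem h0 h1 (by simpa using hz)

theorem dilate_cont {h : ℂ → ℂ} (hh : HolDisc h) {r : ℝ} (h0 : 0 ≤ r) (h1 : r < 1) :
    Continuous fun θ => h ((r : ℂ) * bd θ) := by
  refine ContinuousOn.comp_continuous (s := uDisc) hh.continuousOn
    (continuous_const.mul bd_cont) ?_
  intro θ; exact rmul_mem h0 h1 (bd_norm θ).le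

theorem cauchy_dilate {h : ℂ → ℂ} (hh : HolDisc h) {r : ℝ} (h0 : 0 ≤ r) (h1 : r < 1) (n : ℕ)
    {lam : ℂ} (hlam : lam ∈ uDisc) :
    ∫ θ, h ((r : ℂ) * bd θ) * (bd θ ^ n * conj (ker lam (bd θ))) ∂m
      = h ((r : ℂ) * lam) * lam ^ n := by
  rw [← cauchy (dilate_diffCont hh h0 h1 n) hlam]
  simp only [mul_assoc]

/-- radii tending to one -/
def rad (n : ℕ) : ℝ := 1 - 1 / ((n : ℝ) + 1)

theorem rad_nonneg (n : ℕ) : 0 ≤ rad n := by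
  unfold rad
  rw [sub_nonneg, div_le_one (by positivity)]
  have : (0 : ℝ) ≤ n := by positivity
  linarith

theorem rad_lt (n : ℕ) : rad n < 1 := by
  unfold rad
  have : (0 : ℝ) < 1 / ((n : ℝ) + 1) := by positivity
  linarith

theorem rad_tendsto : Tendsto rad atTop (nhds 1) := by
  unfold rad
  simpa using tendsto_one_div_add_atTop_nhds_zero_nat.const_sub (1 : ℝ)

theorem rad_tendsto' : Tendsto rad atTop (nhdsWithin 1 (Set.Iio 1)) :=
  tendsto_nhdsWithin_iff.2 ⟨rad_tendsto, Eventually.of_forall rad_lt⟩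

theorem bdry_aesm {h : ℂ → ℂ} (hh : HolDisc h) {H : Tc → ℂ} (hb : IsBdry h H) :
    AEStronglyMeasurable H m := by
  refine aestronglyMeasurable_of_tendsto_ae (u := atTop)
    (f := fun (n : ℕ) θ => h ((rad n : ℂ) * bd θ))
    (fun n => (dilate_cont hh (rad_nonneg n) (rad_lt n)).aestronglyMeasurable) ?_
  filter_upwards [hb] with θ hθ
  exact hθ.comp rad_tendsto'

theorem indicator_L1_le {f : Tc → ℂ} (hf : AEStronglyMeasurable f m) (s : Set Tc)
    (hs : MeasurableSet s) :
    eLpNorm (s.indicator f) 1 m ≤ eLpNorm f 2 m * (m s) ^ (1 / 2 : ℝ) := by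
  rw [eLpNorm_indicator_eq_eLpNorm_restrict hs]
  have := eLpNorm_le_eLpNorm_mul_rpow_measure_univ (μ := m.restrict s) (p := 1) (q := 2) (f := f)
    (by norm_num) hf.restrict
  refine this.trans ?_
  rw [Measure.restrict_apply_univ]
  have e : (1 / (1 : ENNReal).toReal - 1 / (2 : ENNReal).toReal : ℝ) = 1 / 2 := by norm_num
  rw [e]
  gcongr
  exact Measure.restrict_le_self

theorem memHp_eLp {h : ℂ → ℂ} (h2 : MemHp 2 h) :
    ∃ C : ℝ, 0 < C ∧ ∀ n, eLpNorm (fun θ => h ((rad n : ℂ) * bd θ)) 2 m ≤ ENNReal.ofReal C := by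
  obtain ⟨hh, C, hC⟩ := h2
  refine ⟨(|C| + 1) ^ (1 / 2 : ℝ), by positivity, fun n => ?_⟩
  have hc := dilate_cont hh (rad_nonneg n) (rad_lt n)
  have hmem : MemLp (fun θ => h ((rad n : ℂ) * bd θ)) 2 m := by
    obtain ⟨B, hB⟩ := (isCompact_range hc).isBounded.exists_norm_le
    exact MemLp.of_bound hc.aestronglyMeasurable B (Eventually.of_forall fun θ => hB _ ⟨θ, rfl⟩)
  rw [hmem.eLpNorm_eq_integral_rpow_norm (by norm_num) (by norm_num)]
  apply ENNReal.ofReal_le_ofReal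
  have := hC (rad n) (rad_nonneg n) (rad_lt n)
  simp only [ENNReal.toReal_ofNat]
  rw [one_div]
  apply Real.rpow_le_rpow
  · positivity
  · exact this.trans ((le_abs_self C).trans (by linarith))
  · norm_num

theorem unif {h : ℂ → ℂ} (h2 : MemHp 2 h) :
    UnifIntegrable (fun n θ => h ((rad n : ℂ) * bd θ)) 1 m := by
  obtain ⟨C, hC0, hC⟩ := memHp_eLp h2
  intro ε hε
  refine ⟨(ε / C) ^ 2, by positivity, fun n s hs hms => ?_⟩
  have hc := dilate_cont h2.1 (rad_nonneg n) (rad_lt n)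
  refine (indicator_L1_le hc.aestronglyMeasurable s hs).trans ?_
  calc _ ≤ ENNReal.ofReal C * (ENNReal.ofReal ((ε / C) ^ 2)) ^ (1 / 2 : ℝ) := by
        gcongr
        exact hC n
    _ = ENNReal.ofReal ε := by
        rw [ENNReal.ofReal_rpow_of_nonneg (by positivity) (by norm_num), ← ENNReal.ofReal_mul hC0.le]
        congr 1
        rw [← Real.sqrt_eq_rpow, Real.sqrt_sq (by positivity)]
        field_simp

theorem bdry_memLp {h : ℂ → ℂ} (h2 : MemHp 2 h) {H : Tc → ℂ} (hb : IsBdry h H) :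
    MemLp H 2 m := by
  obtain ⟨C, hC0, hC⟩ := memHp_eLp h2
  refine ⟨bdry_aesm h2.1 hb, ?_⟩
  have := Lp.eLpNorm_lim_le_liminf_eLpNorm (p := 2) (μ := m)
    (f := fun (n : ℕ) θ => h ((rad n : ℂ) * bd θ))
    (fun n => (dilate_cont h2.1 (rad_nonneg n) (rad_lt n)).aestronglyMeasurable) H
    (by filter_upwards [hb] with θ hθ; exact hθ.comp rad_tendsto')
  refine lt_of_le_of_lt this (lt_of_le_of_lt (b := ENNReal.ofReal C) ?_ ENNReal.ofReal_lt_top)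
  exact (liminf_le_liminf (Eventually.of_forall hC)).trans (by simp)

/-- Cauchy formula for boundary values of `H²` functions. -/
theorem cauchy_bdry {h : ℂ → ℂ} (h2 : MemHp 2 h) {H : Tc → ℂ} (hb : IsBdry h H)
    {lam : ℂ} (hlam : lam ∈ uDisc) (n : ℕ) :
    ∫ θ, H θ * (bd θ ^ n * conj (ker lam (bd θ))) ∂m = h lam * lam ^ n := by
  have hL := bdry_memLp h2 hb
  have hint : Integrable H m := hL.integrable (by norm_num)
  have hcont : Continuous fun θ => bd θ ^ n * conj (ker lam (bd θ)) :=
    (bd_cont.pow n).mul (Complex.continuous_conj.comp (ker_cont hlam))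
  obtain ⟨B, hB⟩ := (isCompact_range hcont).isBounded.exists_norm_le
  have hB' : ∀ θ, ‖bd θ ^ n * conj (ker lam (bd θ))‖ ≤ B := fun θ => hB _ ⟨θ, rfl⟩
  have hci : ∀ k, Integrable (fun θ => h ((rad k : ℂ) * bd θ)) m := fun k =>
    (dilate_cont h2.1 (rad_nonneg k) (rad_lt k)).integrable_of_hasCompactSupport
      (HasCompactSupport.of_compactSpace _)
  have hconv : Tendsto (fun k => eLpNorm ((fun θ => h ((rad k : ℂ) * bd θ)) - H) 1 m)
      atTop (nhds 0) := by
    refine tendsto_Lp_finite_of_tendsto_ae le_rfl (by norm_num) (fun k => (hci k).1)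
      (memLp_one_iff_integrable.2 hint) (unif h2) ?_
    filter_upwards [hb] with θ hθ
    exact hθ.comp rad_tendsto'
  have T1 : Tendsto (fun k => ∫ θ, h ((rad k : ℂ) * bd θ) * (bd θ ^ n * conj (ker lam (bd θ))) ∂m)
      atTop (nhds (∫ θ, H θ * (bd θ ^ n * conj (ker lam (bd θ))) ∂m)) := by
    refine tendsto_integral_of_L1 _ (hint.mul_bdd (c := B) hcont.aestronglyMeasurable
        (Eventually.of_forall hB')).1
      (Eventually.of_forall fun k => (hci k).mul_bdd (c := B) hcont.aestronglyMeasurable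
        (Eventually.of_forall hB')) ?_
    have hz : Tendsto (fun k => eLpNorm ((fun θ => h ((rad k : ℂ) * bd θ)) - H) 1 m *
        ENNReal.ofReal B) atTop (nhds 0) := by
      simpa using ENNReal.Tendsto.mul_const hconv (Or.inr ENNReal.ofReal_ne_top)
    refine tendsto_of_tendsto_of_tendsto_of_le_of_le tendsto_const_nhds hz
      (fun _ => zero_le) fun k => ?_
    simp only [eLpNorm_one_eq_lintegral_enorm]
    rw [← lintegral_mul_const' _ _ ENNReal.ofReal_ne_top]
    refine lintegral_mono fun θ => ?_
    rw [← sub_mul, enorm_mul]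
    simp only [Pi.sub_apply]
    gcongr
    rw [← ofReal_norm]
    exact ENNReal.ofReal_le_ofReal (hB' θ)
  refine tendsto_nhds_unique T1 ?_
  simp only [cauchy_dilate h2.1 (rad_nonneg _) (rad_lt _) n hlam]
  have hc : ContinuousAt h lam := (h2.1.continuousOn).continuousAt (isOpen_ball.mem_nhds hlam)
  refine Tendsto.mul_const _ (hc.tendsto.comp ?_)
  have : Tendsto (fun k => (rad k : ℂ) * lam) atTop (nhds ((1 : ℝ) * lam)) :=
    ((Complex.continuous_ofReal.tendsto _).comp rad_tendsto).mul_const _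
  simpa using this

/-- Poisson kernel between circle points. -/
def PK (r : ℝ) (θ t : Tc) : ℝ := poissonKernel 0 ((r : ℂ) * bd θ) (bd t)

theorem PK_eq {r : ℝ} (h0 : 0 ≤ r) (θ t : Tc) :
    PK r θ t = (1 - r ^ 2) / ‖bd t - r * bd θ‖ ^ 2 := by
  unfold PK poissonKernel
  simp [bd_norm, abs_of_nonneg h0]

theorem PK_nonneg {r : ℝ} (h0 : 0 ≤ r) (h1 : r < 1) (θ t : Tc) : 0 ≤ PK r θ t := by
  rw [PK_eq h0]
  apply div_nonneg _ (by positivity)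
  nlinarith

theorem PK_symm {r : ℝ} (h0 : 0 ≤ r) (θ t : Tc) : PK r θ t = PK r t θ := by
  rw [PK_eq h0, PK_eq h0]
  congr 2
  have h : bd t - r * bd θ = bd t * bd θ * conj (bd θ - r * bd t) := by
    simp only [map_sub, map_mul, Complex.conj_ofReal]
    linear_combination (-bd t) * bd_conj θ + r * bd θ * bd_conj t
  rw [h, norm_mul, norm_mul, RCLike.norm_conj, bd_norm, bd_norm]
  ring

theorem PK_cont {r : ℝ} (h0 : 0 ≤ r) (h1 : r < 1) :
    Continuous fun p : Tc × Tc => PK r p.1 p.2 := by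
  simp only [PK_eq h0]
  have c1 : Continuous fun p : Tc × Tc => bd p.1 := bd_cont.comp continuous_fst
  have c2 : Continuous fun p : Tc × Tc => bd p.2 := bd_cont.comp continuous_snd
  refine Continuous.div continuous_const (by fun_prop) fun p => ?_
  have := bd_sub_ne (rmul_mem h0 h1 (bd_norm p.1).le) p.2
  positivity

theorem PK_cont_t {r : ℝ} (h0 : 0 ≤ r) (h1 : r < 1) (θ : Tc) : Continuous fun t => PK r θ t :=
  (PK_cont h0 h1).comp (g := fun p : Tc × Tc => PK r p.1 p.2) (f := fun t : Tc => (θ, t))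
    (Continuous.prodMk_right θ)

/-- Poisson integral -/
def PI (r : ℝ) (u : Tc → ℂ) (θ : Tc) : ℂ := ∫ t, (PK r θ t : ℂ) * u t ∂m

theorem PI_hol {r : ℝ} (h0 : 0 ≤ r) (h1 : r < 1) (n : ℕ) (θ : Tc) :
    PI r (fun t => bd t ^ n) θ = (r * bd θ) ^ n := by
  have := DiffContOnCl.circleAverage_poissonKernel_smul (c := 0) (R := 1)
    (f := fun z : ℂ => z ^ n) (w := (r : ℂ) * bd θ)
    (DifferentiableOn.diffContOnCl (by fun_prop)) (rmul_mem h0 h1 (bd_norm θ).le)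
  rw [← integral_bd] at this
  rw [← this]
  unfold PI PK
  refine integral_congr_ae (Eventually.of_forall fun t => ?_)
  simp

theorem PI_conj (r : ℝ) (u : Tc → ℂ) (θ : Tc) :
    PI r (fun t => conj (u t)) θ = conj (PI r u θ) := by
  unfold PI
  rw [← integral_conj]
  simp

theorem integrable_PK {r : ℝ} (h0 : 0 ≤ r) (h1 : r < 1) (θ : Tc) {u : Tc → ℂ}
    (hu : Integrable u m) : Integrable (fun t => (PK r θ t : ℂ) * u t) m := by
  have hc : Continuous fun t => (PK r θ t : ℂ) :=
    Complex.continuous_ofReal.comp (PK_cont_t h0 h1 θ)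
  obtain ⟨B, hB⟩ := (isCompact_range hc).isBounded.exists_norm_le
  exact hu.bdd_mul (c := B) hc.aestronglyMeasurable (Eventually.of_forall fun t => hB _ ⟨t, rfl⟩)

theorem PK_integral {r : ℝ} (h0 : 0 ≤ r) (h1 : r < 1) (θ : Tc) : ∫ t, PK r θ t ∂m = 1 := by
  have := PI_hol h0 h1 0 θ
  unfold PI at this
  simp only [pow_zero, mul_one] at this
  rw [integral_complex_ofReal] at this
  exact_mod_cast this

theorem PK_integrable {r : ℝ} (h0 : 0 ≤ r) (h1 : r < 1) (θ : Tc) :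
    Integrable (fun t => PK r θ t) m :=
  (PK_cont_t h0 h1 θ).integrable_of_hasCompactSupport (HasCompactSupport.of_compactSpace _)

theorem PK_lintegral {r : ℝ} (h0 : 0 ≤ r) (h1 : r < 1) (t : Tc) :
    ∫⁻ θ, ‖PK r θ t‖ₑ ∂m = 1 := by
  simp only [PK_symm h0 _ t]
  rw [← ofReal_integral_norm_eq_lintegral_enorm (PK_integrable h0 h1 t)]
  simp only [Real.norm_eq_abs, abs_of_nonneg (PK_nonneg h0 h1 _ _), PK_integral h0 h1,
    ENNReal.ofReal_one]

theorem PI_fourier (n : ℤ) (θ : Tc) :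
    Tendsto (fun k => PI (rad k) (fourier n) θ) atTop (nhds (fourier n θ)) := by
  have key : ∀ n : ℕ, Tendsto (fun k => PI (rad k) (fun t => bd t ^ n) θ) atTop
      (nhds (bd θ ^ n)) := by
    intro n
    simp only [PI_hol (rad_nonneg _) (rad_lt _)]
    have : Tendsto (fun k => ((rad k : ℂ) * bd θ) ^ n) atTop (nhds (((1 : ℝ) * bd θ) ^ n)) :=
      (((Complex.continuous_ofReal.tendsto _).comp rad_tendsto).mul_const _).pow n
    simpa using this
  obtain ⟨k, rfl | rfl⟩ := n.eq_nat_or_neg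
  · simpa only [fourier_nat, ← funext (fourier_nat k)] using key k
  · have h2 : ∀ t : Tc, fourier (-(k : ℤ)) t = conj (bd t ^ k) := by
      intro t; rw [fourier_neg, fourier_nat]
    have h3 : (⇑(fourier (-(k : ℤ))) : Tc → ℂ) = fun t => conj (bd t ^ k) := funext h2
    rw [h3]
    simp only [PI_conj]
    exact (Complex.continuous_conj.tendsto _).comp (key k)

theorem cm_integrable (v : C(Tc, ℂ)) : Integrable v m :=
  v.continuous.integrable_of_hasCompactSupport (HasCompactSupport.of_compactSpace _)

theorem PI_add {r : ℝ} (h0 : 0 ≤ r) (h1 : r < 1) {u v : Tc → ℂ} (hu : Integrable u m)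
    (hv : Integrable v m) (θ : Tc) :
    PI r (fun t => u t + v t) θ = PI r u θ + PI r v θ := by
  unfold PI
  rw [← integral_add (integrable_PK h0 h1 θ hu) (integrable_PK h0 h1 θ hv)]
  simp only [mul_add]

theorem PI_sub {r : ℝ} (h0 : 0 ≤ r) (h1 : r < 1) {u v : Tc → ℂ} (hu : Integrable u m)
    (hv : Integrable v m) (θ : Tc) :
    PI r (fun t => u t - v t) θ = PI r u θ - PI r v θ := by
  unfold PI
  rw [← integral_sub (integrable_PK h0 h1 θ hu) (integrable_PK h0 h1 θ hv)]
  simp only [mul_sub]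

theorem PI_trig (v : C(Tc, ℂ)) (hv : v ∈ Submodule.span ℂ (Set.range (fourier (T := 2 * Real.pi))))
    (θ : Tc) : Tendsto (fun k => PI (rad k) v θ) atTop (nhds (v θ)) := by
  induction hv using Submodule.span_induction with
  | mem x hx => obtain ⟨n, rfl⟩ := hx; exact PI_fourier n θ
  | zero => simp [PI]
  | add x y _ _ hx hy =>
    have : ∀ k, PI (rad k) (⇑(x + y)) θ = PI (rad k) x θ + PI (rad k) y θ := fun k =>
      PI_add (rad_nonneg k) (rad_lt k) (cm_integrable x) (cm_integrable y) θ
    simp only [this]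
    exact hx.add hy
  | smul c x _ hx =>
    have : ∀ k, PI (rad k) (⇑(c • x)) θ = c * PI (rad k) x θ := fun k => by
      unfold PI
      rw [← integral_const_mul]
      refine integral_congr_ae (Eventually.of_forall fun t => ?_)
      simp only [ContinuousMap.coe_smul, Pi.smul_apply, smul_eq_mul]
      ring
    simp only [this]
    exact hx.const_mul c

theorem PI_bound {r : ℝ} (h0 : 0 ≤ r) (h1 : r < 1) (v : C(Tc, ℂ)) (θ : Tc) :
    ‖PI r v θ‖ ≤ ‖v‖ := by
  unfold PI
  refine (norm_integral_le_of_norm_le ((PK_integrable h0 h1 θ).mul_const ‖v‖)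
    (Eventually.of_forall fun t => ?_)).trans ?_
  · rw [norm_mul, Complex.norm_real, Real.norm_eq_abs, abs_of_nonneg (PK_nonneg h0 h1 _ _)]
    exact mul_le_mul_of_nonneg_left (v.norm_coe_le_norm t) (PK_nonneg h0 h1 _ _)
  · rw [integral_mul_const, PK_integral h0 h1, one_mul]

theorem PI_aesm {r : ℝ} (h0 : 0 ≤ r) (h1 : r < 1) {u : Tc → ℂ} (hu : Integrable u m) :
    AEStronglyMeasurable (PI r u) m := by
  unfold PI
  refine AEStronglyMeasurable.integral_prod_right' (μ := m) (ν := m)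
    (f := fun p : Tc × Tc => (PK r p.1 p.2 : ℂ) * u p.2) ?_
  exact (Complex.continuous_ofReal.comp (PK_cont h0 h1)).aestronglyMeasurable.mul hu.1.comp_snd

theorem PI_contract {r : ℝ} (h0 : 0 ≤ r) (h1 : r < 1) {u : Tc → ℂ} (hu : Integrable u m) :
    eLpNorm (PI r u) 1 m ≤ eLpNorm u 1 m := by
  simp only [eLpNorm_one_eq_lintegral_enorm]
  calc ∫⁻ θ, ‖PI r u θ‖ₑ ∂m ≤ ∫⁻ θ, ∫⁻ t, ‖PK r θ t‖ₑ * ‖u t‖ₑ ∂m ∂m := by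
        refine lintegral_mono fun θ => ?_
        refine (enorm_integral_le_lintegral_enorm _).trans ?_
        refine lintegral_mono fun t => ?_
        rw [enorm_mul]
        apply le_of_eq
        congr 1
        rw [← ofReal_norm, ← ofReal_norm, Complex.norm_real]
    _ = ∫⁻ t, ∫⁻ θ, ‖PK r θ t‖ₑ * ‖u t‖ₑ ∂m ∂m := by
        refine lintegral_lintegral_swap ?_
        exact (PK_cont h0 h1).aestronglyMeasurable.enorm.mul hu.1.comp_snd.enorm
    _ = ∫⁻ t, ‖u t‖ₑ ∂m := by
        refine lintegral_congr fun t => ?_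
        rw [lintegral_mul_const' _ _ enorm_ne_top, PK_lintegral h0 h1, one_mul]

theorem trig_dense {u : Tc → ℂ} (hu : Integrable u m) {ε : ENNReal} (hε : ε ≠ 0) :
    ∃ v ∈ Submodule.span ℂ (Set.range (fourier (T := 2 * Real.pi))),
      eLpNorm (fun t => u t - v t) 1 m ≤ ε := by
  have hd : Dense ((ContinuousMap.toLp 1 m ℂ (E := ℂ)) ''
      (Submodule.span ℂ (Set.range (fourier (T := 2 * Real.pi))) : Set C(Tc, ℂ))) := by
    have h1 : DenseRange (ContinuousMap.toLp 1 m ℂ (E := ℂ)) := by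
      unfold m
      exact ContinuousMap.toLp_denseRange ℂ _ ℂ (by norm_num)
    refine h1.dense_image (ContinuousMap.toLp 1 m ℂ (E := ℂ)).continuous ?_
    have := span_fourier_closure_eq_top (T := 2 * Real.pi)
    rw [dense_iff_closure_eq, ← Submodule.topologicalClosure_coe, this]; rfl
  have hm : MemLp u 1 m := memLp_one_iff_integrable.2 hu
  obtain ⟨_, ⟨v, hv, rfl⟩, hlt⟩ := EMetric.mem_closure_iff.1 (hd (hm.toLp u)) ε (pos_iff_ne_zero.2 hε)
  refine ⟨v, hv, ?_⟩
  refine le_trans (le_of_eq ?_) hlt.le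
  rw [Lp.edist_def]
  refine eLpNorm_congr_ae ?_
  filter_upwards [hm.coeFn_toLp, ContinuousMap.coeFn_toLp (p := 1) (𝕜 := ℂ) m v] with t h1 h2
  rw [Pi.sub_apply, h1, h2]

theorem PI_L1 {u : Tc → ℂ} (hu : Integrable u m) :
    Tendsto (fun k => eLpNorm (PI (rad k) u - u) 1 m) atTop (nhds 0) := by
  rw [ENNReal.tendsto_nhds_zero]
  intro ε hε
  have hε3 : ε / 3 ≠ 0 := by simp [hε.ne']
  obtain ⟨v, hv, huv⟩ := trig_dense hu hε3
  have hvi := cm_integrable v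
  have hd : Integrable (fun t => u t - v t) m := hu.sub hvi
  have hT : Tendsto (fun k => eLpNorm (PI (rad k) v - ⇑v) 1 m) atTop (nhds 0) := by
    simp only [eLpNorm_one_eq_lintegral_enorm, Pi.sub_apply]
    have : Tendsto (fun k => ∫⁻ θ, ‖PI (rad k) v θ - v θ‖ₑ ∂m) atTop
        (nhds (∫⁻ θ, 0 ∂m)) := by
      refine tendsto_lintegral_of_dominated_convergence' (fun _ => ENNReal.ofReal (2 * ‖v‖))
        (fun k => ((PI_aesm (rad_nonneg k) (rad_lt k) hvi).sub hvi.1).enorm) (fun k => ?_) ?_ ?_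
      · refine Eventually.of_forall fun θ => ?_
        beta_reduce
        rw [← ofReal_norm]
        apply ENNReal.ofReal_le_ofReal
        refine (norm_sub_le _ _).trans ?_
        have := PI_bound (rad_nonneg k) (rad_lt k) v θ
        have := v.norm_coe_le_norm θ
        linarith
      · rw [lintegral_const, measure_univ, mul_one]
        exact ENNReal.ofReal_ne_top
      · refine Eventually.of_forall fun θ => ?_
        have h := (PI_trig v hv θ).sub_const (v θ)
        rw [sub_self] at h
        simpa using h.enorm
    simpa using this
  filter_upwards [(ENNReal.tendsto_nhds_zero.1 hT) (ε / 3) (pos_iff_ne_zero.2 hε3)] with k hk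
  have e : PI (rad k) u - u = (PI (rad k) (fun t => u t - v t) + (PI (rad k) v - ⇑v))
      - (fun t => u t - v t) := by
    funext θ
    simp only [Pi.sub_apply, Pi.add_apply, PI_sub (rad_nonneg k) (rad_lt k) hu hvi]
    ring
  have m1 := PI_aesm (rad_nonneg k) (rad_lt k) hd
  have m2 := (PI_aesm (rad_nonneg k) (rad_lt k) hvi).sub hvi.1
  rw [e]
  calc _ ≤ eLpNorm (PI (rad k) (fun t => u t - v t) + (PI (rad k) v - ⇑v)) 1 m
          + eLpNorm (fun t => u t - v t) 1 m := eLpNorm_sub_le (m1.add m2) hd.1 le_rfl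
    _ ≤ (eLpNorm (PI (rad k) (fun t => u t - v t)) 1 m + eLpNorm (PI (rad k) v - ⇑v) 1 m)
          + eLpNorm (fun t => u t - v t) 1 m := by
        gcongr
        exact eLpNorm_add_le m1 m2 le_rfl
    _ ≤ ε / 3 + ε / 3 + ε / 3 := by
        gcongr
        exact (PI_contract (rad_nonneg k) (rad_lt k) hd).trans huv
    _ = ε := ENNReal.add_thirds ε

theorem PK_re (r : ℝ) (θ t : Tc) :
    PK r θ t = ((bd t + r * bd θ) / (bd t - r * bd θ)).re := by
  unfold PK
  rw [poissonKernel_eq_re_herglotzRieszKernel]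
  simp [herglotzRieszKernel_def]

theorem outer_kernel_integrable {u : Tc → ℝ} (hu : Integrable u m) {z : ℂ} (hz : z ∈ uDisc) :
    Integrable (fun t => ((bd t + z) / (bd t - z)) * (u t : ℂ)) m := by
  have hc : Continuous fun t => (bd t + z) / (bd t - z) :=
    (bd_cont.add continuous_const).div (bd_cont.sub continuous_const) fun t => bd_sub_ne hz t
  obtain ⟨B, hB⟩ := (isCompact_range hc).isBounded.exists_norm_le
  exact hu.ofReal.bdd_mul (c := B) hc.aestronglyMeasurable
    (Eventually.of_forall fun t => hB _ ⟨t, rfl⟩)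

theorem outer_norm {u : Tc → ℝ} (hu : Integrable u m) {z : ℂ} (hz : z ∈ uDisc) :
    (∫ t, ((bd t + z) / (bd t - z)) * (u t : ℂ) ∂m).re
      = ∫ t, ((bd t + z) / (bd t - z)).re * u t ∂m := by
  have := integral_re (outer_kernel_integrable hu hz)
  simp only [RCLike.re_to_complex] at this
  rw [← this]
  refine integral_congr_ae (Eventually.of_forall fun t => ?_)
  simp

theorem a_bound (P : BPair) : (∀ z ∈ uDisc, ‖P.a z‖ ≤ 1) ∧ (∀ z ∈ uDisc, P.a z ≠ 0) := by
  obtain ⟨hol, α, w, hα, -, hw, hform⟩ := P.a_outer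
  set u : Tc → ℝ := fun θ => Real.log (w θ) with hu_def
  have hnorm : ∀ z ∈ uDisc, ‖P.a z‖ = Real.exp (∫ t, ((bd t + z) / (bd t - z)).re * u t ∂m) := by
    intro z hz
    rw [hform z hz, norm_mul, hα, one_mul, Complex.norm_exp, outer_norm hw hz]
  have hPI : ∀ k θ, ‖P.a ((rad k : ℂ) * bd θ)‖ = Real.exp ((PI (rad k) (fun t => (u t : ℂ)) θ).re) := by
    intro k θ
    rw [hnorm _ (rmul_mem (rad_nonneg k) (rad_lt k) (bd_norm θ).le)]
    congr 1
    unfold PI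
    simp only [PK_re, ← Complex.ofReal_mul]
    rw [integral_complex_ofReal, Complex.ofReal_re]
  have hui : Integrable (fun t => (u t : ℂ)) m := hw.ofReal
  have hmeas := tendstoInMeasure_of_tendsto_eLpNorm (one_ne_zero)
    (fun k => PI_aesm (rad_nonneg k) (rad_lt k) hui) hui.1 (PI_L1 hui)
  obtain ⟨ns, hns, hae⟩ := hmeas.exists_seq_tendsto_ae
  have hu0 : ∀ᵐ θ ∂m, u θ ≤ 0 := by
    filter_upwards [hae, P.a_bdry, P.pyth] with θ h1 h2 h3
    have t1 : Tendsto (fun i => ‖P.a ((rad (ns i) : ℂ) * bd θ)‖) atTop (nhds (Real.exp (u θ))) := by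
      simp only [hPI]
      have := (Real.continuous_exp.comp Complex.continuous_re).continuousAt.tendsto.comp h1
      simpa [Function.comp_def] using this
    have t2 : Tendsto (fun i => ‖P.a ((rad (ns i) : ℂ) * bd θ)‖) atTop (nhds ‖P.as' θ‖) :=
      (h2.comp (rad_tendsto'.comp hns.tendsto_atTop)).norm
    have e := tendsto_nhds_unique t1 t2
    have : ‖P.as' θ‖ ≤ 1 := by nlinarith [sq_nonneg ‖P.bs θ‖, norm_nonneg (P.as' θ)]
    rw [← e] at this
    exact Real.exp_le_one_iff.1 this
  refine ⟨fun z hz => ?_, fun z hz => ?_⟩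
  · rw [hnorm z hz, Real.exp_le_one_iff]
    refine integral_nonpos_of_ae ?_
    filter_upwards [hu0] with t ht
    refine mul_nonpos_of_nonneg_of_nonpos ?_ ht
    have := congrFun (poissonKernel_eq_re_herglotzRieszKernel (c := 0) (w := z)) (bd t)
    simp only [Function.comp_apply, herglotzRieszKernel_def, sub_zero] at this
    rw [← this, poissonKernel_def]
    have hz' : ‖z‖ < 1 := by simpa using hz
    simp only [sub_zero, bd_norm]
    apply div_nonneg _ (by positivity)
    nlinarith [norm_nonneg z]
  · rw [← norm_pos_iff, hnorm z hz]
    exact Real.exp_pos _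

theorem a_memHp (P : BPair) : MemHp 2 P.a := by
  refine ⟨P.a_outer.1, 1, fun r h0 h1 => ?_⟩
  have : ∫ θ : Tc, ‖P.a ((r : ℂ) * bd θ)‖ ^ (2 : ℝ) ∂m ≤ ∫ θ : Tc, (1 : ℝ) ∂m := by
    refine integral_mono_of_nonneg (Eventually.of_forall fun θ => by positivity)
      (integrable_const _) (Eventually.of_forall fun θ => ?_)
    exact Real.rpow_le_one (norm_nonneg _)
      ((a_bound P).1 _ (rmul_mem h0 h1 (bd_norm θ).le)) (by norm_num)
  simpa using this

theorem ker_rec {lam : ℂ} (hlam : lam ∈ uDisc) (θ : Tc) :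
    ker lam (bd θ) = 1 + conj lam * (bd θ * ker lam (bd θ)) := by
  have h := one_sub_ne hlam (bd_norm θ).le
  have : (1 - conj lam * bd θ) * ker lam (bd θ) = 1 := by
    unfold _root_.ker; exact mul_inv_cancel₀ h
  linear_combination this

theorem fourierCoeff_neg (u : Tc → ℂ) (n : ℕ) :
    fourierCoeff u (-(n : ℤ)) = ∫ θ, bd θ ^ n * u θ ∂m := by
  unfold fourierCoeff m
  simp only [neg_neg, fourier_nat, smul_eq_mul]

theorem fourierCoeff_nonneg (u : Tc → ℂ) (n : ℕ) :
    fourierCoeff u (n : ℤ) = ∫ θ, conj (bd θ ^ n) * u θ ∂m := by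
  unfold fourierCoeff m
  simp only [fourier_neg, fourier_nat, smul_eq_mul]

theorem ker_bdd {lam : ℂ} (hlam : lam ∈ uDisc) : ∃ B, ∀ θ, ‖ker lam (bd θ)‖ ≤ B := by
  obtain ⟨B, hB⟩ := (isCompact_range (ker_cont hlam)).isBounded.exists_norm_le
  exact ⟨B, fun θ => hB _ ⟨θ, rfl⟩⟩

theorem mul_bd_integrable {u : Tc → ℂ} (hu : Integrable u m) (n : ℕ) :
    Integrable (fun θ => bd θ ^ n * u θ) m :=
  hu.bdd_mul (c := 1) (bd_cont.pow n).aestronglyMeasurable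
    (Eventually.of_forall fun θ => by simp [bd_norm])

theorem neg_coeff_mul_ker {u : Tc → ℂ} (hu : Integrable u m)
    (h : ∀ n : ℤ, n < 0 → fourierCoeff u n = 0) {lam : ℂ} (hlam : lam ∈ uDisc) :
    ∀ n : ℤ, n < 0 → fourierCoeff (fun θ => u θ * ker lam (bd θ)) n = 0 := by
  obtain ⟨B, hB⟩ := ker_bdd hlam
  have huk : Integrable (fun θ => u θ * ker lam (bd θ)) m :=
    hu.mul_bdd (c := B) (ker_cont hlam).aestronglyMeasurable (Eventually.of_forall hB)
  set c : ℕ → ℂ := fun n => ∫ θ, bd θ ^ n * (u θ * ker lam (bd θ)) ∂m with hc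
  have hrec : ∀ n, 0 < n → c n = conj lam * c (n + 1) := by
    intro n hn
    have h0 : ∫ θ, bd θ ^ n * u θ ∂m = 0 := by
      rw [← fourierCoeff_neg]; exact h _ (by omega)
    have e : c n = ∫ θ, (bd θ ^ n * u θ + conj lam * (bd θ ^ (n + 1) * (u θ * ker lam (bd θ)))) ∂m := by
      refine integral_congr_ae (Eventually.of_forall fun θ => ?_)
      have := ker_rec hlam θ
      simp only
      linear_combination bd θ ^ n * u θ * this
    rw [e, integral_add (mul_bd_integrable hu n) ((mul_bd_integrable huk (n + 1)).const_mul _), h0,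
      zero_add, integral_const_mul]
  have hpow : ∀ n, 0 < n → ∀ j, c n = conj lam ^ j * c (n + j) := by
    intro n hn j
    induction j with
    | zero => simp
    | succ j ih => rw [ih, hrec (n + j) (by omega), pow_succ, mul_assoc, add_assoc]
  have hbd : ∀ n, ‖c n‖ ≤ ∫ θ, ‖u θ * ker lam (bd θ)‖ ∂m := by
    intro n
    refine norm_integral_le_of_norm_le huk.norm (Eventually.of_forall fun θ => ?_)
    rw [norm_mul, norm_pow, bd_norm, one_pow, one_mul]
  have hl : ‖lam‖ < 1 := by simpa using hlam
  have hzero : ∀ n, 0 < n → c n = 0 := by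
    intro n hn
    have t : Tendsto (fun j => ‖lam‖ ^ j * ∫ θ, ‖u θ * ker lam (bd θ)‖ ∂m) atTop (nhds 0) := by
      simpa using (tendsto_pow_atTop_nhds_zero_of_lt_one (norm_nonneg _) hl).mul_const
        (∫ θ, ‖u θ * ker lam (bd θ)‖ ∂m)
    rw [← norm_le_zero_iff]
    refine ge_of_tendsto' t fun j => ?_
    rw [hpow n hn j, norm_mul, norm_pow, RCLike.norm_conj]
    exact mul_le_mul_of_nonneg_left (hbd _) (by positivity)
  intro n hn
  obtain ⟨k, rfl⟩ : ∃ k : ℕ, n = -(k : ℤ) := ⟨n.natAbs, by omega⟩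
  rw [fourierCoeff_neg]
  exact hzero k (by omega)

theorem coeff_congr {u v : Tc → ℂ} (h : u =ᵐ[m] v) (n : ℤ) : fourierCoeff u n = fourierCoeff v n := by
  unfold fourierCoeff
  refine integral_congr_ae ?_
  filter_upwards [h] with t ht
  rw [ht]

theorem const_coeff (c : ℂ) (n : ℤ) (hn : n < 0) : fourierCoeff (fun _ : Tc => c) n = 0 := by
  obtain ⟨k, rfl⟩ : ∃ k : ℕ, n = -(k : ℤ) := ⟨n.natAbs, by omega⟩
  rw [fourierCoeff_neg]
  have := cauchy (φ := fun z => z ^ k * c) (lam := 0)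
    (DifferentiableOn.diffContOnCl (by fun_prop)) (by simp)
  have hk : k ≠ 0 := by omega
  simpa [_root_.ker, hk] using this

/-- Let `f ∈ H(b)`, `λ ∈ 𝔻`, and let `g ∈ H²` be the unique function with
`conj(b)·f = conj(a)·f⁺ + conj(z)·conj(g)` a.e. on `𝕋`. Then `f·k_λ ∈ H(b)` and
`(f·k_λ)⁺ = f⁺·k_λ + (conj(λ·g(λ))/conj(a(λ)))·k_λ`. -/
theorem stmt_0 (P : BPair) (f : ℂ → ℂ) (F Fp : L2) (g : ℂ → ℂ) (Gs : Tc → ℂ) (lam : ℂ)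
    (hlam : lam ∈ uDisc)
    (hf2 : MemHp 2 f) (hfF : IsBdry f (F : Tc → ℂ)) (hfHb : HbMem P F Fp)
    (hg2 : MemHp 2 g) (hgG : IsBdry g Gs)
    (hgrel : ∀ᵐ θ ∂m, conj (P.bs θ) * (F : Tc → ℂ) θ =
      conj (P.as' θ) * (Fp : Tc → ℂ) θ + conj (bd θ) * conj (Gs θ)) :
    ∃ FK FKp : L2,
      HbMem P FK FKp ∧
      IsBdry (fun z => f z * ker lam z) (FK : Tc → ℂ) ∧
      ((FK : Tc → ℂ) =ᵐ[m] fun θ => (F : Tc → ℂ) θ * ker lam (bd θ)) ∧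
      ((FKp : Tc → ℂ) =ᵐ[m] fun θ =>
        (Fp : Tc → ℂ) θ * ker lam (bd θ) +
          (conj (lam * g lam) / conj (P.a lam)) * ker lam (bd θ)) := by
  obtain ⟨hF, hFp, -⟩ := hfHb
  obtain ⟨B, hB⟩ := ker_bdd hlam
  have hkc := ker_cont hlam
  have hk_lp : MemLp (fun θ => ker lam (bd θ)) ⊤ m :=
    memLp_top_of_bound hkc.aestronglyMeasurable B (Eventually.of_forall hB)
  set c : ℂ := conj (lam * g lam) / conj (P.a lam) with hc
  have hFi : Integrable (F : Tc → ℂ) m := (Lp.memLp F).integrable (by norm_num)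
  have hFpi : Integrable (Fp : Tc → ℂ) m := (Lp.memLp Fp).integrable (by norm_num)
  have m1 : MemLp (fun θ => (F : Tc → ℂ) θ * ker lam (bd θ)) 2 m := hk_lp.mul (Lp.memLp F)
  have hFpc : MemLp (fun θ => (Fp : Tc → ℂ) θ + c) 2 m := (Lp.memLp Fp).add (memLp_const c)
  have m2' : MemLp (fun θ => ((Fp : Tc → ℂ) θ + c) * ker lam (bd θ)) 2 m := hk_lp.mul hFpc
  have m2 : MemLp (fun θ => (Fp : Tc → ℂ) θ * ker lam (bd θ) + c * ker lam (bd θ)) 2 m := by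
    simpa only [add_mul] using m2'
  have e1 := m1.coeFn_toLp
  have e2 := m2.coeFn_toLp
  refine ⟨m1.toLp _, m2.toLp _, ⟨?_, ?_, ?_⟩, ?_, e1, e2⟩
  · intro n hn
    rw [coeff_congr e1]
    exact neg_coeff_mul_ker hFi hF hlam n hn
  · intro n hn
    rw [coeff_congr e2]
    simp only [← add_mul]
    refine neg_coeff_mul_ker (hFpc.integrable (by norm_num)) (fun k hk => ?_) hlam n hn
    have := fourierCoeff.add (f := (Fp : Tc → ℂ)) (g := fun _ => c) hFpi (integrable_const c)
    have h2 := congrFun this k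
    simp only [Pi.add_apply] at h2
    rw [hFp k hk, const_coeff c k hk, add_zero] at h2
    exact h2
  · intro n hn
    obtain ⟨k, rfl⟩ := Int.eq_ofNat_of_zero_le hn
    have hG := cauchy_bdry hg2 hgG hlam (k + 1)
    have hA := cauchy_bdry (a_memHp P) P.a_bdry hlam k
    have hGi : Integrable Gs m := (bdry_memLp hg2 hgG).integrable (by norm_num)
    have hAi : Integrable P.as' m := (bdry_memLp (a_memHp P) P.a_bdry).integrable (by norm_num)
    have hbdd : ∀ (v : Tc → ℂ) (j : ℕ), Integrable v m →
        Integrable (fun θ => v θ * (bd θ ^ j * conj (ker lam (bd θ)))) m := by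
      intro v j hv
      refine hv.mul_bdd (c := B)
        ((bd_cont.pow j).mul (Complex.continuous_conj.comp hkc)).aestronglyMeasurable
        (Eventually.of_forall fun θ => ?_)
      rw [norm_mul, norm_pow, bd_norm, one_pow, one_mul, RCLike.norm_conj]
      exact hB θ
    rw [fourierCoeff_nonneg]
    have key : ∫ θ, conj (bd θ ^ k) * (conj (P.bs θ) * (m1.toLp _ : Tc → ℂ) θ
          - conj (P.as' θ) * (m2.toLp _ : Tc → ℂ) θ) ∂m
        = ∫ θ, conj (Gs θ * (bd θ ^ (k + 1) * conj (ker lam (bd θ)))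
          - conj c * (P.as' θ * (bd θ ^ k * conj (ker lam (bd θ))))) ∂m := by
      refine integral_congr_ae ?_
      filter_upwards [e1, e2, hgrel] with θ h1 h2 h3
      rw [h1, h2]
      simp only [map_sub, map_mul, map_pow, Complex.conj_conj]
      linear_combination (conj (bd θ)) ^ k * ker lam (bd θ) * h3
    rw [key, integral_conj, integral_sub (hbdd _ _ hGi) ((hbdd _ _ hAi).const_mul _),
      integral_const_mul, hG, hA]
    have ha := (a_bound P).2 lam hlam
    have hcc : conj c = lam * g lam / P.a lam := by
      rw [hc, map_div₀, Complex.conj_conj, Complex.conj_conj]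
    rw [hcc]
    have : g lam * lam ^ (k + 1) - lam * g lam / P.a lam * (P.a lam * lam ^ k) = 0 := by
      field_simp
      ring
    rw [this, map_zero]
  · filter_upwards [hfF, e1] with θ h1 h2
    rw [h2]
    refine h1.mul ?_
    have hcont : ContinuousAt (fun r : ℝ => ker lam ((r : ℂ) * bd θ)) 1 := by
      unfold _root_.ker
      refine ContinuousAt.inv₀ (by fun_prop) ?_
      exact one_sub_ne hlam (by simp [bd_norm])
    have := hcont.tendsto.mono_left (nhdsWithin_le_nhds (s := Set.Iio 1))
    simpa using this

end
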